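/- Let Φ be a real m×n matrix and let G = ΦᵀΦ be its Gram matrix. Let K be a natural number with 1 ≤ K ≤ n, and suppose δ_d > 0, δ_o > 0 and δ_d + δ_o = δ_K ∈ (0,1). If the diagonal entries of G satisfy |G_{ii} − 1| < δ_d for every i, and the off-diagonal entries satisfy |G_{ij}| < δ_o / K for all i ≠ j, then Φ satisfies RIP(K, δ_K). -/

import Mathlib

open Matrix Finset

/-- A matrix `Φ ∈ ℝ^{m×n}` satisfies RIP(K, δ) if
`(1−δ)‖α‖₂² ≤ ‖Φα‖₂² ≤ (1+δ)‖α‖₂²` for every vector `α` with at most `K` nonzero entries. -/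
def RIP {α β : Type*} [Fintype α] [Fintype β] (Φ : Matrix α β ℝ) (K : ℕ) (δ : ℝ) : Prop :=
  ∀ v : β → ℝ, (Finset.univ.filter fun j => v j ≠ 0).card ≤ K →
    (1 - δ) * (∑ j, v j ^ 2) ≤ ∑ i, (Φ.mulVec v i) ^ 2 ∧
      ∑ i, (Φ.mulVec v i) ^ 2 ≤ (1 + δ) * (∑ j, v j ^ 2)

/-- If the diagonal entries of the Gram matrix `G = ΦᵀΦ` satisfy `|G_{ii} − 1| < δ_d` and
the off-diagonal entries satisfy `|G_{ij}| < δ_o / K` (with `δ_d + δ_o = δ_K ∈ (0,1)`),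
then `Φ` satisfies RIP(K, δ_K). -/
theorem rip_of_gram_entries {m n : ℕ} (Φ : Matrix (Fin m) (Fin n) ℝ)
    (G : Matrix (Fin n) (Fin n) ℝ) (hG : G = Φᵀ * Φ)
    (K : ℕ) (hK1 : 1 ≤ K) (hKn : K ≤ n)
    (δd δo δK : ℝ) (hδd : 0 < δd) (hδo : 0 < δo)
    (hsum : δd + δo = δK) (hδK : δK ∈ Set.Ioo (0 : ℝ) 1)
    (hdiag : ∀ i, |G i i - 1| < δd)
    (hoff : ∀ i j, i ≠ j → |G i j| < δo / K) :
    RIP Φ K δK := by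
  intro v hv
  have hKpos : (0 : ℝ) < K := by exact_mod_cast hK1
  have hexp : ∑ i, (Φ.mulVec v i) ^ 2 = ∑ j, ∑ k, v j * v k * G j k := by
    subst hG
    simp only [Matrix.mulVec, dotProduct, Matrix.mul_apply, Matrix.transpose_apply, sq,
      Finset.mul_sum]
    rw [Finset.sum_comm]
    refine Finset.sum_congr rfl fun j _ => ?_
    rw [Finset.sum_comm]
    refine Finset.sum_congr rfl fun k _ => ?_
    rw [Finset.sum_mul]
    refine Finset.sum_congr rfl fun i _ => ?_
    ring
  have hid : ∑ j, v j ^ 2 = ∑ j, ∑ k, v j * v k * (if j = k then (1 : ℝ) else 0) := by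
    simp [sq]
  have hcs : (∑ j, |v j|) ^ 2 ≤ K * ∑ j, v j ^ 2 := by
    have h1 : ∑ j, |v j| = ∑ j ∈ Finset.univ.filter (fun j => v j ≠ 0), |v j| := by
      rw [Finset.sum_filter]
      refine Finset.sum_congr rfl fun j _ => ?_
      by_cases h : v j = 0 <;> simp [h]
    have h2 := sq_sum_le_card_mul_sum_sq (s := Finset.univ.filter (fun j => v j ≠ 0))
      (f := fun j => |v j|)
    rw [h1]
    refine h2.trans ?_
    have h3 : ∑ j ∈ Finset.univ.filter (fun j => v j ≠ 0), |v j| ^ 2 ≤ ∑ j, v j ^ 2 := by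
      simp only [sq_abs]
      exact Finset.sum_le_sum_of_subset_of_nonneg (Finset.subset_univ _)
        (fun j _ _ => sq_nonneg (v j))
    have h4 : ((Finset.univ.filter (fun j => v j ≠ 0)).card : ℝ) ≤ K := by exact_mod_cast hv
    exact mul_le_mul h4 h3 (Finset.sum_nonneg fun j _ => sq_nonneg _) hKpos.le
  have hmain : |∑ i, (Φ.mulVec v i) ^ 2 - ∑ j, v j ^ 2| ≤ δK * ∑ j, v j ^ 2 := by
    have hb : ∀ j k, |v j * v k * G j k - v j * v k * (if j = k then (1 : ℝ) else 0)| ≤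
        δd * (v j * v k * (if j = k then (1 : ℝ) else 0)) + δo / K * (|v j| * |v k|) := by
      intro j k
      rw [← mul_sub, abs_mul, abs_mul]
      have hp : 0 ≤ |v j| * |v k| := by positivity
      have hq : 0 ≤ δo / K := by positivity
      by_cases h : j = k
      · subst h
        simp only [if_true, mul_one]
        rw [abs_mul_abs_self] at *
        nlinarith [mul_le_mul_of_nonneg_left (hdiag j).le hp, mul_nonneg hq hp]
      · simp only [h, if_false, mul_zero, sub_zero, zero_add]
        nlinarith [mul_le_mul_of_nonneg_left (hoff j k h).le hp]
    calc |∑ i, (Φ.mulVec v i) ^ 2 - ∑ j, v j ^ 2|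
        = |∑ j, ∑ k, (v j * v k * G j k - v j * v k * (if j = k then (1 : ℝ) else 0))| := by
          rw [hexp, hid]; simp only [Finset.sum_sub_distrib]
      _ ≤ ∑ j, ∑ k, (δd * (v j * v k * (if j = k then (1 : ℝ) else 0))
            + δo / K * (|v j| * |v k|)) :=
          (Finset.abs_sum_le_sum_abs _ _).trans (Finset.sum_le_sum fun j _ =>
            (Finset.abs_sum_le_sum_abs _ _).trans (Finset.sum_le_sum fun k _ => hb j k))
      _ = δd * ∑ j, v j ^ 2 + δo / K * (∑ j, |v j|) ^ 2 := by
          rw [hid, sq, Finset.sum_mul_sum]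
          simp only [Finset.sum_add_distrib, Finset.mul_sum]
      _ ≤ δd * ∑ j, v j ^ 2 + δo / K * (K * ∑ j, v j ^ 2) := by gcongr
      _ = δK * ∑ j, v j ^ 2 := by
          rw [← hsum]; field_simp
  have := abs_le.mp hmain
  constructor <;> linarith [this.1, this.2]
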